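/- Let G be a tidy (H,𝒫)-graph such that every path P ∈ 𝒫 has at least 8·|𝒫| vertices. Given any contraction sequence C_H of H, there exists a contraction sequence of G of width at most max(w(C_H) + 1, 4). -/

import Mathlib

attribute [local instance] Classical.propDecidable

open Finset

universe u

/-- A trigraph: a finite graph whose edge set is partitioned into black and red edges. -/
structure Trigraph (V : Type u) where
  verts : Finset V
  black : Finset (Sym2 V)
  red : Finset (Sym2 V)
  black_nodiag : ∀ e ∈ black, ¬ e.IsDiag
  red_nodiag : ∀ e ∈ red, ¬ e.IsDiag
  black_support : ∀ e ∈ black, ∀ x ∈ e, x ∈ verts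
  red_support : ∀ e ∈ red, ∀ x ∈ e, x ∈ verts
  disj : Disjoint black red

namespace Trigraph

variable {V : Type u}

def BlackAdj (G : Trigraph V) (x y : V) : Prop := s(x, y) ∈ G.black
def RedAdj (G : Trigraph V) (x y : V) : Prop := s(x, y) ∈ G.red
def Adj (G : Trigraph V) (x y : V) : Prop := G.BlackAdj x y ∨ G.RedAdj x y

noncomputable def redDeg (G : Trigraph V) (x : V) : ℕ := (G.red.filter (fun e => x ∈ e)).card
noncomputable def blackDeg (G : Trigraph V) (x : V) : ℕ := (G.black.filter (fun e => x ∈ e)).card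
noncomputable def deg (G : Trigraph V) (x : V) : ℕ :=
  ((G.black ∪ G.red).filter (fun e => x ∈ e)).card
noncomputable def maxRedDeg (G : Trigraph V) : ℕ := G.verts.sup G.redDeg

/-- The black edges after contracting `v` into `u`. -/
noncomputable def cBlack (G : Trigraph V) (u v : V) : Finset (Sym2 V) :=
  G.black.filter (fun e => u ∉ e ∧ v ∉ e) ∪
    ((G.verts.erase v).filter
      (fun y => y ≠ u ∧ s(u, y) ∈ G.black ∧ s(v, y) ∈ G.black)).image (fun y => s(u, y))

/-- The red edges after contracting `v` into `u`. -/
noncomputable def cRed (G : Trigraph V) (u v : V) : Finset (Sym2 V) :=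
  G.red.filter (fun e => u ∉ e ∧ v ∉ e) ∪
    ((G.verts.erase v).filter
      (fun y => y ≠ u ∧ ¬(s(u, y) ∈ G.black ∧ s(v, y) ∈ G.black) ∧
        (s(u, y) ∈ G.red ∨ s(v, y) ∈ G.red ∨
          ¬((s(u, y) ∈ G.black) ↔ (s(v, y) ∈ G.black))))).image (fun y => s(u, y))

/-- Contraction of the two distinct vertices `u, v` of `G`: `v` is removed, `u` becomes the
new merged vertex; a black edge survives towards a common black neighbor, and a red edge is
created towards any other remaining neighbor of `u` or `v`. If `u = v` or one of them is not a
vertex, `G` is returned unchanged. -/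
noncomputable def contract (G : Trigraph V) (u v : V) : Trigraph V :=
  if h : u ≠ v ∧ u ∈ G.verts ∧ v ∈ G.verts then
    { verts := G.verts.erase v
      black := cBlack G u v
      red := cRed G u v
      black_nodiag := by
        intro e he
        rcases Finset.mem_union.1 he with he | he
        · exact G.black_nodiag e (Finset.mem_filter.1 he).1
        · obtain ⟨y, hy, rfl⟩ := Finset.mem_image.1 he
          have hyu : y ≠ u := ((Finset.mem_filter.1 hy).2).1
          simpa [Sym2.isDiag_iff_proj_eq] using fun hh => hyu (Eq.symm hh)
      red_nodiag := by
        intro e he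
        rcases Finset.mem_union.1 he with he | he
        · exact G.red_nodiag e (Finset.mem_filter.1 he).1
        · obtain ⟨y, hy, rfl⟩ := Finset.mem_image.1 he
          have hyu : y ≠ u := ((Finset.mem_filter.1 hy).2).1
          simpa [Sym2.isDiag_iff_proj_eq] using fun hh => hyu (Eq.symm hh)
      black_support := by
        intro e he x hx
        rcases Finset.mem_union.1 he with he | he
        · rcases Finset.mem_filter.1 he with ⟨heb, hu, hv⟩
          refine Finset.mem_erase.2 ⟨?_, G.black_support e heb x hx⟩
          rintro rfl; exact hv hx
        · obtain ⟨y, hy, rfl⟩ := Finset.mem_image.1 he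
          rcases Sym2.mem_iff.1 hx with rfl | rfl
          · exact Finset.mem_erase.2 ⟨h.1.symm ∘ Eq.symm, h.2.1⟩
          · exact (Finset.mem_filter.1 hy).1
      red_support := by
        intro e he x hx
        rcases Finset.mem_union.1 he with he | he
        · rcases Finset.mem_filter.1 he with ⟨heb, hu, hv⟩
          refine Finset.mem_erase.2 ⟨?_, G.red_support e heb x hx⟩
          rintro rfl; exact hv hx
        · obtain ⟨y, hy, rfl⟩ := Finset.mem_image.1 he
          rcases Sym2.mem_iff.1 hx with rfl | rfl
          · exact Finset.mem_erase.2 ⟨h.1.symm ∘ Eq.symm, h.2.1⟩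
          · exact (Finset.mem_filter.1 hy).1
      disj := by
        rw [Finset.disjoint_left]
        intro e heb her
        rcases Finset.mem_union.1 heb with heb | heb <;>
          rcases Finset.mem_union.1 her with her | her
        · exact Finset.disjoint_left.1 G.disj (Finset.mem_filter.1 heb).1
            (Finset.mem_filter.1 her).1
        · obtain ⟨y, hy, hey⟩ := Finset.mem_image.1 her
          exact ((Finset.mem_filter.1 heb).2).1 (hey ▸ Sym2.mem_mk_left u y)
        · obtain ⟨y, hy, hey⟩ := Finset.mem_image.1 heb
          exact ((Finset.mem_filter.1 her).2).1 (hey ▸ Sym2.mem_mk_left u y)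
        · obtain ⟨y, hy, hey⟩ := Finset.mem_image.1 heb
          obtain ⟨y', hy', hey'⟩ := Finset.mem_image.1 her
          have : y = y' := Sym2.congr_right.1 (hey.trans hey'.symm)
          subst this
          exact (((Finset.mem_filter.1 hy').2).2).1 ((Finset.mem_filter.1 hy).2).2 }
  else G

/-- The trigraph obtained from `G` by performing the contractions recorded in `ps`
(each pair `(u, v)` contracts `v` into `u`). -/
noncomputable def stage (G : Trigraph V) (ps : List (V × V)) : Trigraph V :=
  ps.foldl (fun H p => H.contract p.1 p.2) G

/-- The list `ps` records genuine contractions (distinct current vertices) starting from `G`. -/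
noncomputable def ValidSteps : Trigraph V → List (V × V) → Prop
  | _, [] => True
  | G, p :: ps =>
      p.1 ≠ p.2 ∧ p.1 ∈ G.verts ∧ p.2 ∈ G.verts ∧ ValidSteps (G.contract p.1 p.2) ps

/-- `ps` encodes a (complete) contraction sequence of `G`, ending in a one-vertex trigraph. -/
noncomputable def IsContractionSeq (G : Trigraph V) (ps : List (V × V)) : Prop :=
  ValidSteps G ps ∧ (stage G ps).verts.card = 1

/-- The width of the (partial) contraction sequence of `G` encoded by `ps`: the maximum red
degree appearing in any of its trigraphs. -/
noncomputable def seqWidth (G : Trigraph V) (ps : List (V × V)) : ℕ :=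
  ((List.range (ps.length + 1)).map (fun j => (stage G (ps.take j)).maxRedDeg)).foldr max 0

/-- The twin-width of a trigraph: the minimum width of a contraction sequence. -/
noncomputable def tww (G : Trigraph V) : ℕ :=
  sInf {t | ∃ ps, G.IsContractionSeq ps ∧ G.seqWidth ps ≤ t}

/-- Where the original vertex `x` currently lives after the contractions in `ps`. -/
noncomputable def collapse (ps : List (V × V)) (x : V) : V :=
  ps.foldl (fun y p => if y = p.2 then p.1 else y) x

/-- The bag of a vertex `u` after the contractions in `ps`: all original vertices of `G`
contracted into `u`. -/
noncomputable def bag (G : Trigraph V) (ps : List (V × V)) (u : V) : Finset V :=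
  G.verts.filter (fun x => collapse ps x = u)

/-- The induced subtrigraph on a vertex set `Q`. -/
noncomputable def induce (G : Trigraph V) (Q : Finset V) : Trigraph V where
  verts := G.verts ∩ Q
  black := G.black.filter (fun e => ∀ x ∈ e, x ∈ Q)
  red := G.red.filter (fun e => ∀ x ∈ e, x ∈ Q)
  black_nodiag := fun e he => G.black_nodiag e (Finset.mem_filter.1 he).1
  red_nodiag := fun e he => G.red_nodiag e (Finset.mem_filter.1 he).1
  black_support := fun e he x hx =>
    Finset.mem_inter.2 ⟨G.black_support e (Finset.mem_filter.1 he).1 x hx,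
      (Finset.mem_filter.1 he).2 x hx⟩
  red_support := fun e he x hx =>
    Finset.mem_inter.2 ⟨G.red_support e (Finset.mem_filter.1 he).1 x hx,
      (Finset.mem_filter.1 he).2 x hx⟩
  disj := Finset.disjoint_filter_filter G.disj

/-- The underlying simple graph of a trigraph (ignoring colors). -/
def toSimple (G : Trigraph V) : SimpleGraph V :=
  SimpleGraph.fromEdgeSet ↑(G.black ∪ G.red)

/-- A trigraph is connected if it is nonempty and all pairs of its vertices are joined by paths. -/
def Conn (G : Trigraph V) : Prop :=
  G.verts.Nonempty ∧ ∀ x ∈ G.verts, ∀ y ∈ G.verts, G.toSimple.Reachable x y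

/-- Distance from a vertex `x` to a set `A` of vertices. -/
noncomputable def distToSet (G : Trigraph V) (A : Finset V) (x : V) : ℕ :=
  sInf {d | ∃ a ∈ A, G.toSimple.dist x a = d}

end Trigraph

namespace Trigraph

variable {V : Type u}

/-- A dangling red path in `G`: a nonempty list of distinct vertices of `G`, with consecutive
vertices joined by red edges, in which every vertex has degree 2 in `G`. -/
def IsDanglingRedPath (G : Trigraph V) (p : List V) : Prop :=
  p ≠ [] ∧ p.Nodup ∧ p.Chain' G.RedAdj ∧ ∀ x ∈ p, x ∈ G.verts ∧ G.deg x = 2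

/-- `G` is a tidy `(H, 𝒫)`-graph (Definition 5): `G` is connected with `tww(G) ≥ 2`, `𝒫` is a
nonempty set of pairwise disjoint dangling red paths, `H` (given by its vertex set `HV`) and
the disjoint union `⊔𝒫` are disjoint induced subtrigraphs covering all of `G`, and every
vertex of `H` with a neighbor in `⊔𝒫` has black degree 0 and exactly that one neighbor
in `⊔𝒫`. -/
structure IsTidy (G : Trigraph V) (HV : Finset V) (P : Finset (List V)) : Prop where
  conn : G.Conn
  tww_ge : 2 ≤ G.tww
  Pne : P.Nonempty
  paths : ∀ p ∈ P, G.IsDanglingRedPath p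
  pathsDisj : ∀ p ∈ P, ∀ q ∈ P, p ≠ q → ∀ x ∈ p, x ∉ q
  Hsub : HV ⊆ G.verts
  Hdisj : ∀ p ∈ P, ∀ x ∈ p, x ∉ HV
  cover : ∀ x ∈ G.verts, x ∈ HV ∨ ∃ p ∈ P, x ∈ p
  pathsInduced : ∀ p ∈ P, ∀ x ∈ p, ∀ y ∈ p, G.Adj x y → ([x, y] <:+: p ∨ [y, x] <:+: p)
  noPathPathEdges : ∀ p ∈ P, ∀ q ∈ P, p ≠ q → ∀ x ∈ p, ∀ y ∈ q, ¬ G.Adj x y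
  boundary : ∀ u ∈ HV, ∀ v, (∃ p ∈ P, v ∈ p) → G.Adj u v →
    G.blackDeg u = 0 ∧ ∀ w, (∃ p ∈ P, w ∈ p) → G.Adj u w → w = v

/-- The part `H'` of a trigraph obtained from `G` by the contractions `ps`: the vertices
whose bag is contained in `HV`. -/
noncomputable def Hpart (G : Trigraph V) (HV : Finset V) (ps : List (V × V)) : Finset V :=
  (stage G ps).verts.filter (fun u => bag G ps u ⊆ HV)

/-- The vertex set of `F`: the vertices outside `H` at distance at most `2m` from `H`. -/
noncomputable def Fverts (G : Trigraph V) (HV : Finset V) (m : ℕ) : Finset V :=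
  (G.verts \ HV).filter (fun x => G.distToSet HV x ≤ 2 * m)

/-- The part `F'` of a trigraph obtained from `G` by the contractions `ps`: the vertices
whose bag is contained in `V(F)`. -/
noncomputable def Fpart (G : Trigraph V) (HV : Finset V) (m : ℕ) (ps : List (V × V)) :
    Finset V :=
  (stage G ps).verts.filter (fun u => bag G ps u ⊆ Fverts G HV m)

/-- The level of a vertex: the (common) distance from `H` in `G` of the vertices in its bag. -/
noncomputable def level (G : Trigraph V) (HV : Finset V) (ps : List (V × V)) (u : V) : ℕ :=
  sInf {d | ∃ x ∈ bag G ps u, G.distToSet HV x = d}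

/-- The connected component of `u` in the forest `F'`. -/
noncomputable def Fcomp (G : Trigraph V) (HV : Finset V) (m : ℕ) (ps : List (V × V)) (u : V) :
    Finset V :=
  (Fpart G HV m ps).filter
    (fun w => ((stage G ps).induce (Fpart G HV m ps)).toSimple.Reachable u w)

/-- The degree-3 vertices of the component of `u` in `F'`. -/
noncomputable def Fcomp3 (G : Trigraph V) (HV : Finset V) (m : ℕ) (ps : List (V × V)) (u : V) :
    Finset V :=
  (Fcomp G HV m ps u).filter (fun w => (stage G ps).deg w = 3)

/-- The trigraph reached from `G` by the contractions `ps` is `G`-tidy (Definition 7), for a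
tidy `(H, 𝒫)`-graph `G` with `m = |𝒫|`. -/
structure IsGTidy (G : Trigraph V) (HV : Finset V) (m : ℕ) (ps : List (V × V)) : Prop where
  valid : ValidSteps G ps
  basic : ∀ u ∈ (stage G ps).verts,
      u ∈ Hpart G HV ps ∨ u ∈ Fpart G HV m ps ∨ (bag G ps u).card = 1
  outs : ∀ u ∈ Hpart G HV ps,
      (((stage G ps).verts \ Hpart G HV ps).filter (fun v => (stage G ps).Adj u v)).card ≤ 1
  levels : ∀ u ∈ Fpart G HV m ps, ∀ x ∈ bag G ps u, ∀ y ∈ bag G ps u,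
      G.distToSet HV x = G.distToSet HV y
  forest : ((stage G ps).induce (Fpart G HV m ps)).toSimple.IsAcyclic
  deg_le : ∀ u ∈ Fpart G HV m ps, (stage G ps).deg u ≤ 3
  comp_cond : ∀ u ∈ Fpart G HV m ps,
      ∃ r ∈ Fcomp G HV m ps u, level G HV ps r = 1 ∧
        (∀ r' ∈ Fcomp G HV m ps u, level G HV ps r' = 1 → r' = r) ∧
        (∀ a ∈ Fcomp3 G HV m ps u, ∀ b ∈ Fcomp3 G HV m ps u,
          ((stage G ps).induce (Fcomp3 G HV m ps u)).toSimple.Reachable a b) ∧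
        (∀ w ∈ Fcomp3 G HV m ps u, level G HV ps w ≤ (bag G ps r).card - 1) ∧
        (Fcomp3 G HV m ps u = ∅ ∨ r ∈ Fcomp3 G HV m ps u)

end Trigraph

namespace Trigraph

variable {V : Type u}

theorem ext_adj {G H : Trigraph V} (hv : G.verts = H.verts)
    (hb : ∀ x y, G.BlackAdj x y ↔ H.BlackAdj x y) (hr : ∀ x y, G.RedAdj x y ↔ H.RedAdj x y) :
    G = H := by
  have h1 : G.black = H.black := by
    ext e; induction e with | _ x y => exact hb x y
  have h2 : G.red = H.red := by
    ext e; induction e with | _ x y => exact hr x y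
  cases G; cases H
  simp only at hv h1 h2
  subst hv h1 h2
  rfl

theorem BlackAdj.symm {G : Trigraph V} {x y : V} (h : G.BlackAdj x y) : G.BlackAdj y x := by
  unfold BlackAdj at *; rwa [Sym2.eq_swap]

theorem RedAdj.symm {G : Trigraph V} {x y : V} (h : G.RedAdj x y) : G.RedAdj y x := by
  unfold RedAdj at *; rwa [Sym2.eq_swap]

theorem Adj.symm {G : Trigraph V} {x y : V} (h : G.Adj x y) : G.Adj y x :=
  h.imp BlackAdj.symm RedAdj.symm

theorem Adj.left_mem {G : Trigraph V} {x y : V} (h : G.Adj x y) : x ∈ G.verts :=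
  h.elim (fun h => G.black_support _ h x (Sym2.mem_mk_left x y))
    (fun h => G.red_support _ h x (Sym2.mem_mk_left x y))

theorem Adj.right_mem {G : Trigraph V} {x y : V} (h : G.Adj x y) : y ∈ G.verts :=
  h.symm.left_mem

theorem Adj.ne {G : Trigraph V} {x y : V} (h : G.Adj x y) : x ≠ y := by
  rintro rfl
  exact h.elim (fun h => G.black_nodiag _ h (by simp)) (fun h => G.red_nodiag _ h (by simp))

/-- Counting edges at a vertex amounts to counting neighbours. -/
theorem card_filter_mem_eq {E : Finset (Sym2 V)} {X : Finset V}
    (hsupp : ∀ e ∈ E, ∀ x ∈ e, x ∈ X) (x : V) :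
    (E.filter (fun e => x ∈ e)).card = (X.filter (fun y => s(x, y) ∈ E)).card := by
  symm
  refine Finset.card_bij (fun y _ => s(x, y)) ?_ ?_ ?_
  · intro y hy
    simpa using (Finset.mem_filter.1 hy).2
  · intro y _ z _ h
    exact Sym2.congr_right.1 h
  · intro e he
    obtain ⟨he, hx⟩ := Finset.mem_filter.1 he
    obtain ⟨y, rfl⟩ := Sym2.mem_iff_exists.1 hx
    exact ⟨y, Finset.mem_filter.2 ⟨hsupp _ he y (Sym2.mem_mk_right x y), he⟩, rfl⟩

theorem redDeg_eq (G : Trigraph V) (x : V) :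
    G.redDeg x = (G.verts.filter (fun y => G.RedAdj x y)).card := by
  unfold redDeg
  rw [card_filter_mem_eq G.red_support]
  congr 1; ext y; rw [Finset.mem_filter, Finset.mem_filter, RedAdj]

theorem deg_eq (G : Trigraph V) (x : V) :
    G.deg x = (G.verts.filter (fun y => G.Adj x y)).card := by
  unfold deg
  rw [card_filter_mem_eq (X := G.verts)]
  · congr 1; ext y
    rw [Finset.mem_filter, Finset.mem_filter, Adj, BlackAdj, RedAdj, Finset.mem_union]
  · intro e he
    exact (Finset.mem_union.1 he).elim (G.black_support e) (G.red_support e)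

theorem mk_mem_image_mk {X : Finset V} {u x y : V} :
    s(x, y) ∈ X.image (fun z => s(u, z)) ↔ (x = u ∧ y ∈ X) ∨ (y = u ∧ x ∈ X) := by
  simp only [Finset.mem_image, Sym2.eq_iff]
  constructor
  · rintro ⟨z, hz, ⟨rfl, rfl⟩ | ⟨rfl, rfl⟩⟩ <;> simp [hz]
  · rintro (⟨rfl, h⟩ | ⟨rfl, h⟩) <;> exact ⟨_, h, by simp⟩

theorem contract_verts {G : Trigraph V} {u v : V} (h : u ≠ v) (hu : u ∈ G.verts)
    (hv : v ∈ G.verts) : (G.contract u v).verts = G.verts.erase v := by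
  unfold contract; rw [dif_pos ⟨h, hu, hv⟩]

theorem contract_blackAdj {G : Trigraph V} {u v : V} (h : u ≠ v) (hu : u ∈ G.verts)
    (hv : v ∈ G.verts) (x y : V) :
    (G.contract u v).BlackAdj x y ↔
      (G.BlackAdj x y ∧ x ≠ u ∧ x ≠ v ∧ y ≠ u ∧ y ≠ v) ∨
      (x = u ∧ y ≠ u ∧ y ≠ v ∧ G.BlackAdj u y ∧ G.BlackAdj v y) ∨
      (y = u ∧ x ≠ u ∧ x ≠ v ∧ G.BlackAdj u x ∧ G.BlackAdj v x) := by
  have key : ∀ z, G.BlackAdj u z → z ∈ G.verts := fun z hz => Adj.right_mem (Or.inl hz)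
  unfold contract; rw [dif_pos ⟨h, hu, hv⟩]
  unfold BlackAdj at *
  simp only [cBlack, Finset.mem_union, mk_mem_image_mk, Finset.mem_filter, Finset.mem_erase,
    Sym2.mem_iff, not_or]
  grind

theorem contract_redAdj {G : Trigraph V} {u v : V} (h : u ≠ v) (hu : u ∈ G.verts)
    (hv : v ∈ G.verts) (x y : V) :
    (G.contract u v).RedAdj x y ↔
      (G.RedAdj x y ∧ x ≠ u ∧ x ≠ v ∧ y ≠ u ∧ y ≠ v) ∨
      (x = u ∧ y ≠ u ∧ y ≠ v ∧ ¬ (G.BlackAdj u y ∧ G.BlackAdj v y) ∧ (G.Adj u y ∨ G.Adj v y)) ∨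
      (y = u ∧ x ≠ u ∧ x ≠ v ∧ ¬ (G.BlackAdj u x ∧ G.BlackAdj v x) ∧
        (G.Adj u x ∨ G.Adj v x)) := by
  have key : ∀ z, G.Adj u z ∨ G.Adj v z → z ∈ G.verts :=
    fun z hz => hz.elim Adj.right_mem Adj.right_mem
  unfold contract; rw [dif_pos ⟨h, hu, hv⟩]
  unfold Adj BlackAdj RedAdj at *
  simp only [cRed, Finset.mem_union, mk_mem_image_mk, Finset.mem_filter, Finset.mem_erase,
    Sym2.mem_iff, not_or]
  grind

theorem exists_adj_of_contract_adj {G : Trigraph V} {u v : V} (h : u ≠ v) (hu : u ∈ G.verts)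
    (hv : v ∈ G.verts) {x y : V} (hxy : (G.contract u v).Adj x y) :
    ∃ x' y', G.Adj x' y' ∧ (x' = x ∨ x' = v ∧ x = u) ∧ (y' = y ∨ y' = v ∧ y = u) := by
  rcases hxy with hxy | hxy
  · rw [contract_blackAdj h hu hv] at hxy
    rcases hxy with h1 | ⟨rfl, -, -, h1, -⟩ | ⟨rfl, -, -, h1, -⟩
    · exact ⟨x, y, Or.inl h1.1, Or.inl rfl, Or.inl rfl⟩
    · exact ⟨x, y, Or.inl h1, Or.inl rfl, Or.inl rfl⟩
    · exact ⟨x, y, Or.inl h1.symm, Or.inl rfl, Or.inl rfl⟩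
  · rw [contract_redAdj h hu hv] at hxy
    rcases hxy with h1 | ⟨rfl, -, -, -, h1⟩ | ⟨rfl, -, -, -, h1⟩
    · exact ⟨x, y, Or.inr h1.1, Or.inl rfl, Or.inl rfl⟩
    · exact h1.elim (fun h1 => ⟨x, y, h1, Or.inl rfl, Or.inl rfl⟩)
        (fun h1 => ⟨v, y, h1, Or.inr ⟨rfl, rfl⟩, Or.inl rfl⟩)
    · exact h1.elim (fun h1 => ⟨x, y, h1.symm, Or.inl rfl, Or.inl rfl⟩)
        (fun h1 => ⟨x, v, h1.symm, Or.inl rfl, Or.inr ⟨rfl, rfl⟩⟩)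

theorem induce_verts (G : Trigraph V) (Q : Finset V) : (G.induce Q).verts = G.verts ∩ Q := rfl

theorem induce_blackAdj (G : Trigraph V) (Q : Finset V) (x y : V) :
    (G.induce Q).BlackAdj x y ↔ G.BlackAdj x y ∧ x ∈ Q ∧ y ∈ Q := by
  simp [induce, BlackAdj]

theorem induce_redAdj (G : Trigraph V) (Q : Finset V) (x y : V) :
    (G.induce Q).RedAdj x y ↔ G.RedAdj x y ∧ x ∈ Q ∧ y ∈ Q := by
  simp [induce, RedAdj]

theorem induce_contract_of_notMem {G : Trigraph V} {Q : Finset V} {u v : V} (h : u ≠ v)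
    (hu : u ∈ G.verts) (hv : v ∈ G.verts) (huQ : u ∉ Q) (hvQ : v ∉ Q) :
    (G.contract u v).induce Q = G.induce Q := by
  apply ext_adj
  · rw [induce_verts, induce_verts, contract_verts h hu hv]
    ext x; simp only [Finset.mem_inter, Finset.mem_erase]; grind
  · intro x y
    rw [induce_blackAdj, induce_blackAdj, contract_blackAdj h hu hv]; grind
  · intro x y
    rw [induce_redAdj, induce_redAdj, contract_redAdj h hu hv]; grind

theorem induce_contract_of_mem {G : Trigraph V} {Q : Finset V} {u v : V} (h : u ≠ v)
    (hu : u ∈ G.verts) (hv : v ∈ G.verts) (huQ : u ∈ Q) (hvQ : v ∈ Q) :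
    (G.contract u v).induce Q = (G.induce Q).contract u v := by
  have hu' : u ∈ (G.induce Q).verts := Finset.mem_inter.2 ⟨hu, huQ⟩
  have hv' : v ∈ (G.induce Q).verts := Finset.mem_inter.2 ⟨hv, hvQ⟩
  apply ext_adj
  · rw [induce_verts, contract_verts h hu hv, contract_verts h hu' hv', induce_verts]
    ext x; simp only [Finset.mem_inter, Finset.mem_erase]; grind
  · intro x y
    rw [induce_blackAdj, contract_blackAdj h hu hv, contract_blackAdj h hu' hv']
    simp only [induce_blackAdj]; grind
  · intro x y
    rw [induce_redAdj, contract_redAdj h hu hv, contract_redAdj h hu' hv']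
    simp only [Adj, induce_blackAdj, induce_redAdj]; grind

theorem seqWidth_le_iff {G : Trigraph V} {ps : List (V × V)} {t : ℕ} :
    G.seqWidth ps ≤ t ↔ ∀ j ≤ ps.length, (stage G (ps.take j)).maxRedDeg ≤ t := by
  have aux : ∀ l : List ℕ, l.foldr max 0 ≤ t ↔ ∀ a ∈ l, a ≤ t := by
    intro l
    induction l with
    | nil => simp
    | cons a l ih => simp [ih]
  unfold seqWidth
  rw [aux]
  simp

theorem maxRedDeg_le_seqWidth (G : Trigraph V) (ps : List (V × V)) :
    G.maxRedDeg ≤ G.seqWidth ps := by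
  simpa [stage] using seqWidth_le_iff.1 (le_refl (G.seqWidth ps)) 0 (Nat.zero_le _)

theorem seqWidth_contract_le (G : Trigraph V) (p : V × V) (ps : List (V × V)) :
    (G.contract p.1 p.2).seqWidth ps ≤ G.seqWidth (p :: ps) := by
  rw [seqWidth_le_iff]
  intro j hj
  simpa [stage] using seqWidth_le_iff.1 (le_refl (G.seqWidth (p :: ps))) (j + 1) (by simpa using hj)

/-- `S` arises from `G` by a partial contraction sequence of width at most `t`. -/
def Reaches (G : Trigraph V) (t : ℕ) (S : Trigraph V) : Prop :=
  ∃ ps, ValidSteps G ps ∧ stage G ps = S ∧ G.seqWidth ps ≤ t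

theorem Reaches.refl {G : Trigraph V} {t : ℕ} (h : G.maxRedDeg ≤ t) : G.Reaches t G :=
  ⟨[], trivial, rfl, by simpa [seqWidth, stage] using h⟩

theorem validSteps_concat (u v : V) (ps : List (V × V)) : ∀ (G : Trigraph V), ValidSteps G ps →
    u ≠ v → u ∈ (stage G ps).verts → v ∈ (stage G ps).verts →
    ValidSteps G (ps ++ [(u, v)]) := by
  induction ps with
  | nil => exact fun G _ h hu hv => ⟨h, hu, hv, trivial⟩
  | cons p ps ih => exact fun G hG h hu hv => ⟨hG.1, hG.2.1, hG.2.2.1, ih _ hG.2.2.2 h hu hv⟩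

theorem Reaches.contract {G S : Trigraph V} {t : ℕ} (hS : G.Reaches t S) {u v : V} (h : u ≠ v)
    (hu : u ∈ S.verts) (hv : v ∈ S.verts) (ht : (S.contract u v).maxRedDeg ≤ t) :
    G.Reaches t (S.contract u v) := by
  obtain ⟨ps, hps, rfl, hw⟩ := hS
  have hst : stage G (ps ++ [(u, v)]) = (stage G ps).contract u v := by simp [stage]
  refine ⟨ps ++ [(u, v)], validSteps_concat u v ps G hps h hu hv, hst, ?_⟩
  rw [seqWidth_le_iff] at hw ⊢
  intro j hj
  rcases Nat.lt_or_ge ps.length j with hlt | hge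
  · rw [List.take_of_length_le (by simpa using hlt), hst]
    exact ht
  · rw [List.take_append_of_le_length hge]
    exact hw j hge

/-- `S` has one vertex for each class of the labelling `F` of the vertices of `G`, and all its
edges come from edges of `G`. -/
structure IsQuotient {Λ : Type*} (G S : Trigraph V) (F : V → Λ) : Prop where
  sub : S.verts ⊆ G.verts
  inj : Set.InjOn F S.verts
  surj : ∀ x ∈ G.verts, ∃ s ∈ S.verts, F s = F x
  adj : ∀ a b, S.Adj a b → ∃ x y, G.Adj x y ∧ F x = F a ∧ F y = F b

theorem IsQuotient.self {Λ : Type*} {G : Trigraph V} {F : V → Λ} (h : Set.InjOn F G.verts) :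
    G.IsQuotient G F :=
  ⟨Finset.Subset.refl _, h, fun x hx => ⟨x, hx, rfl⟩, fun a b hab => ⟨a, b, hab, rfl, rfl⟩⟩

theorem IsQuotient.of_ker {Λ Λ' : Type*} {G S : Trigraph V} {F : V → Λ} {F' : V → Λ'}
    (h : G.IsQuotient S F)
    (hF : ∀ x ∈ G.verts, ∀ y ∈ G.verts, F x = F y ↔ F' x = F' y) : G.IsQuotient S F' := by
  refine ⟨h.sub, ?_, ?_, ?_⟩
  · intro a ha b hb hab
    exact h.inj ha hb ((hF a (h.sub ha) b (h.sub hb)).2 hab)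
  · intro x hx
    obtain ⟨s, hs, hsx⟩ := h.surj x hx
    exact ⟨s, hs, (hF s (h.sub hs) x hx).1 hsx⟩
  · intro a b hab
    obtain ⟨x, y, hxy, hx, hy⟩ := h.adj a b hab
    exact ⟨x, y, hxy, (hF _ hxy.left_mem _ (h.sub hab.left_mem)).1 hx,
      (hF _ hxy.right_mem _ (h.sub hab.right_mem)).1 hy⟩

theorem IsQuotient.contract {Λ : Type*} [DecidableEq Λ] {G S : Trigraph V} {F F' : V → Λ}
    (h : G.IsQuotient S F) {u v : V} (huv : u ≠ v) (hu : u ∈ S.verts) (hv : v ∈ S.verts)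
    (hF : ∀ x, F' x = if F x = F v then F u else F x) : G.IsQuotient (S.contract u v) F' := by
  have hverts := contract_verts huv hu hv
  have hinj : ∀ a ∈ S.verts, ∀ b ∈ S.verts, F a = F b → a = b := fun a ha b hb => h.inj ha hb
  refine ⟨?_, ?_, ?_, ?_⟩
  · rw [hverts]; exact (Finset.erase_subset _ _).trans h.sub
  · rw [hverts]
    intro a ha b hb hab
    simp only [Finset.coe_erase, Set.mem_sdiff, Finset.mem_coe, Set.mem_singleton_iff] at ha hb
    rw [hF, hF] at hab
    grind
  · intro x hx
    obtain ⟨s, hs, hsx⟩ := h.surj x hx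
    rw [hverts]
    by_cases hsv : s = v
    · refine ⟨u, Finset.mem_erase.2 ⟨huv, hu⟩, ?_⟩
      rw [hF, hF]; grind
    · refine ⟨s, Finset.mem_erase.2 ⟨hsv, hs⟩, ?_⟩
      rw [hF, hF, hsx]
  · intro a b hab
    obtain ⟨a', b', hab', ha, hb⟩ := exists_adj_of_contract_adj huv hu hv hab
    obtain ⟨x, y, hxy, hx, hy⟩ := h.adj a' b' hab'
    refine ⟨x, y, hxy, ?_, ?_⟩
    · rw [hF, hF, hx]; grind
    · rw [hF, hF, hy]; grind

/-- Identify two labels, which amounts to one contraction or to none at all. -/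
theorem IsQuotient.exists_relabel {Λ : Type*} [DecidableEq Λ] {G S : Trigraph V}
    {F F' : V → Λ} {t : ℕ} {Q : Finset V} (h : G.IsQuotient S F) (hS : G.Reaches t S) {a b : Λ}
    (hab : a ≠ b)
    (hF : ∀ x, F' x = if F x = b then a else F x) (hQ : ∀ x ∈ Q, F x ≠ a ∧ F x ≠ b)
    (ht : ∀ S' : Trigraph V, G.IsQuotient S' F' → S'.induce Q = S.induce Q → S'.maxRedDeg ≤ t) :
    ∃ S' : Trigraph V, G.IsQuotient S' F' ∧ G.Reaches t S' ∧ S'.induce Q = S.induce Q := by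
  by_cases hex : (∃ x ∈ G.verts, F x = a) ∧ ∃ x ∈ G.verts, F x = b
  · obtain ⟨⟨x, hx, hxa⟩, y, hy, hyb⟩ := hex
    obtain ⟨u, hu, hua⟩ := h.surj x hx
    obtain ⟨v, hv, hvb⟩ := h.surj y hy
    have huv : u ≠ v := by grind
    have h1 : G.IsQuotient (S.contract u v) F' := h.contract huv hu hv (by grind)
    have h2 : (S.contract u v).induce Q = S.induce Q :=
      induce_contract_of_notMem huv hu hv (by grind) (by grind)
    exact ⟨_, h1, hS.contract huv hu hv (ht _ h1 h2), h2⟩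
  · refine ⟨S, h.of_ker ?_, hS, rfl⟩
    intro x hx y hy
    rw [hF, hF]
    grind

theorem IsQuotient.card_neighbors_le {Λ : Type*} {G S : Trigraph V} {F : V → Λ}
    (h : G.IsQuotient S F) (s : V) (X : Finset V) (T : Finset Λ)
    (hT : ∀ x y, F x = F s → G.Adj x y → (∃ z ∈ X, F z = F y) → F y ≠ F s → F y ∈ T) :
    (S.verts.filter (fun y => S.Adj s y ∧ y ∈ X)).card ≤ T.card := by
  refine Finset.card_le_card_of_injOn F ?_ ?_
  · intro y hy
    obtain ⟨hyS, hsy, hyX⟩ := Finset.mem_filter.1 (Finset.mem_coe.1 hy)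
    obtain ⟨x, y', hxy, hx, hy'⟩ := h.adj s y hsy
    have := hT x y' hx hxy ⟨y, hyX, hy'.symm⟩ (by
      rw [hy']; intro hh; exact hsy.ne (h.inj hsy.left_mem hyS hh.symm))
    simpa [hy'] using this
  · intro y hy z hz
    exact h.inj (Finset.mem_filter.1 (Finset.mem_coe.1 hy)).1
      (Finset.mem_filter.1 (Finset.mem_coe.1 hz)).1

theorem IsQuotient.redDeg_le {Λ : Type*} {G S : Trigraph V} {F : V → Λ}
    (h : G.IsQuotient S F) (s : V) (T : Finset Λ)
    (hT : ∀ x y, F x = F s → G.Adj x y → F y ≠ F s → F y ∈ T) : S.redDeg s ≤ T.card := by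
  rw [redDeg_eq]
  refine le_trans (Finset.card_le_card ?_)
    (h.card_neighbors_le s S.verts T fun x y hx hxy _ => hT x y hx hxy)
  intro y hy
  obtain ⟨h1, h2⟩ := Finset.mem_filter.1 hy
  exact Finset.mem_filter.2 ⟨h1, Or.inr h2, h1⟩

theorem IsQuotient.redDeg_le_induce {Λ : Type*} {G S : Trigraph V} {F : V → Λ} {Q : Finset V}
    (h : G.IsQuotient S F) {s : V} (hs : s ∈ Q) (T : Finset Λ)
    (hT : ∀ x y, F x = F s → G.Adj x y → (∃ z ∈ S.verts \ Q, F z = F y) → F y ∈ T) :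
    S.redDeg s ≤ (S.induce Q).redDeg s + T.card := by
  rw [redDeg_eq, redDeg_eq]
  refine le_trans (Finset.card_le_card ?_) ((Finset.card_union_le _ _).trans (Nat.add_le_add_left
    (h.card_neighbors_le s (S.verts \ Q) T fun x y hx hxy hz _ => hT x y hx hxy hz) _))
  intro y hy
  obtain ⟨h1, h2⟩ := Finset.mem_filter.1 hy
  simp only [Finset.mem_union, Finset.mem_filter, induce_redAdj, induce_verts, Finset.mem_inter,
    Finset.mem_sdiff, Adj]
  tauto

/-- Coordinates on a trigraph `G` in which `Q` is joined by strands of vertices at levels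
`1, 2, …`. The vertices of `Q` and the strand vertices that are to be merged level by level form
the spine; each level is left by at most one strand, and the remaining free vertices lie in
columns which are paths. -/
structure Coords (G : Trigraph V) (Q : Finset V) where
  spine : V → Prop
  lev : V → ℕ
  base : V → V
  col : V → ℕ
  row : V → ℕ
  mem_iff : ∀ x, x ∈ Q ↔ spine x ∧ lev x = 0
  base_self : ∀ x ∈ Q, base x = x
  base_mem : ∀ x, spine x → base x ∈ Q
  spine_inj : ∀ x y, spine x → spine y → lev x = lev y → base x = base y → x = y
  spine_adj : ∀ x y, G.Adj x y → spine x → spine y →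
    (lev x = 0 ∧ lev y = 0) ∨ base x = base y ∧ (lev y = lev x + 1 ∨ lev x = lev y + 1)
  exit_lev : ∀ x y, G.Adj x y → spine x → ¬ spine y → 2 ≤ lev x
  exit_unique : ∀ x y x' y', G.Adj x y → spine x → ¬ spine y → G.Adj x' y' → spine x' →
    ¬ spine y' → lev x = lev x' → y = y'
  exit_col : ∀ x y, G.Adj x y → spine x → ¬ spine y →
    (lev x = col y ∧ row y = lev x + 1) ∨ lev x = col y + 1
  free_card : ∀ x ∈ G.verts, ¬ spine x → (G.verts.filter (fun y => G.Adj x y)).card ≤ 4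
  free_inj : ∀ x ∈ G.verts, ∀ y ∈ G.verts, ¬ spine x → ¬ spine y →
    col x = col y → row x = row y → x = y
  free_adj : ∀ x y, G.Adj x y → ¬ spine x → ¬ spine y →
    col x = col y ∧ (row y = row x + 1 ∨ row x = row y + 1)
  row_pos : ∀ x, ¬ spine x → 0 < row x

namespace Coords

variable {G : Trigraph V} {Q : Finset V} (D : Coords G Q)

/-- Spine vertices are labelled by their level and the image of their base point under the
map attached to this level; free vertices are labelled by themselves. -/
noncomputable def label (C : ℕ → V → V) (x : V) : (V × ℕ) ⊕ V :=
  if D.spine x then Sum.inl (C (D.lev x) (D.base x), D.lev x) else Sum.inr x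

theorem label_of_spine {C : ℕ → V → V} {x : V} (h : D.spine x) :
    D.label C x = Sum.inl (C (D.lev x) (D.base x), D.lev x) := if_pos h

theorem label_of_not_spine {C : ℕ → V → V} {x : V} (h : ¬ D.spine x) :
    D.label C x = Sum.inr x := if_neg h

theorem label_of_mem {C : ℕ → V → V} {x : V} (h : x ∈ Q) :
    D.label C x = Sum.inl (C 0 x, 0) := by
  obtain ⟨h1, h2⟩ := (D.mem_iff x).1 h
  rw [D.label_of_spine h1, h2, D.base_self x h]

theorem mem_of_label_eq {C C' : ℕ → V → V} {x y : V} (h : D.label C x = D.label C' y)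
    (hy : y ∈ Q) : x ∈ Q := by
  rw [D.label_of_mem hy, label] at h
  rw [D.mem_iff]
  split_ifs at h with hx
  simp only [Sum.inl.injEq, Prod.mk.injEq] at h
  exact ⟨hx, h.2⟩

/-- The map `c` followed, on the levels in `A`, by sending `v` to `u`. -/
noncomputable def mix (A : ℕ → Prop) (u v : V) (c : V → V) (l : ℕ) (b : V) : V :=
  if A l ∧ c b = v then u else c b

theorem label_mix {A A' : ℕ → Prop} {l : ℕ} (hA : ∀ k, A' k ↔ A k ∨ k = l)
    (u v : V) (c : V → V) (x : V) :
    D.label (mix A' u v c) x =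
      if D.label (mix A u v c) x = Sum.inl (v, l) then Sum.inl (u, l)
      else D.label (mix A u v c) x := by
  by_cases hx : D.spine x
  · simp only [D.label_of_spine hx, mix, Sum.inl.injEq, Prod.mk.injEq]
    grind
  · simp [D.label_of_not_spine hx]

theorem exists_mix_image (A : ℕ → Prop) (u v : V) (c : V → V) (l l' : ℕ) (w : V) :
    ∃ T : Finset V, T.card ≤ (if A l ∧ ¬ A l' then 2 else 1) ∧
      ∀ b, mix A u v c l b = w → mix A u v c l' b ∈ T := by
  by_cases h : A l ∧ ¬ A l'
  · refine ⟨{w, v}, by rw [if_pos h]; exact Finset.card_le_two, ?_⟩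
    intro b hb
    simp only [mix, Finset.mem_insert, Finset.mem_singleton] at *
    grind
  · refine ⟨{if A l' ∧ w = v then u else w}, by rw [if_neg h]; simp, ?_⟩
    intro b hb
    simp only [mix, Finset.mem_singleton] at *
    grind

theorem exists_exit (l : ℕ) : ∃ T : Finset V, T.card ≤ (if 2 ≤ l then 1 else 0) ∧
    ∀ x y, G.Adj x y → D.spine x → ¬ D.spine y → D.lev x = l → y ∈ T := by
  by_cases h : ∃ x y, G.Adj x y ∧ D.spine x ∧ ¬ D.spine y ∧ D.lev x = l
  · obtain ⟨x, y, hxy, hx, hy, rfl⟩ := h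
    refine ⟨{y}, by simp [D.exit_lev x y hxy hx hy], ?_⟩
    intro x' y' hxy' hx' hy' hl
    exact Finset.mem_singleton.2 (D.exit_unique _ _ _ _ hxy' hx' hy' hxy hx hy hl)
  · refine ⟨∅, by simp, ?_⟩
    intro x y hxy hx hy hl
    exact (h ⟨x, y, hxy, hx, hy, hl⟩).elim

theorem exists_label_neighbors {A : ℕ → Prop} (hA : ∀ l ≥ 2, A l → A (l - 1) ∨ A (l + 1))
    (u v : V) (c : V → V) {x : V} (hx : x ∈ G.verts) (hxQ : x ∉ Q) :
    ∃ T : Finset ((V × ℕ) ⊕ V), T.card ≤ 4 ∧ ∀ x' y,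
      D.label (mix A u v c) x' = D.label (mix A u v c) x → G.Adj x' y →
        D.label (mix A u v c) y ∈ T := by
  by_cases hsp : D.spine x
  · have hl : 1 ≤ D.lev x := by
      have := D.mem_iff x
      by_contra h
      exact hxQ (this.2 ⟨hsp, by omega⟩)
    set l := D.lev x with hldef
    obtain ⟨T1, hc1, h1⟩ := exists_mix_image A u v c l (l - 1) (mix A u v c l (D.base x))
    obtain ⟨T2, hc2, h2⟩ := exists_mix_image A u v c l (l + 1) (mix A u v c l (D.base x))
    obtain ⟨T3, hc3, h3⟩ := D.exists_exit l
    refine ⟨T1.image (fun w => Sum.inl (w, l - 1)) ∪ T2.image (fun w => Sum.inl (w, l + 1)) ∪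
      T3.image Sum.inr, ?_, ?_⟩
    · have e1 := Finset.card_union_le (T1.image (fun w => (Sum.inl (w, l - 1) : (V × ℕ) ⊕ V)) ∪
        T2.image (fun w => Sum.inl (w, l + 1))) (T3.image Sum.inr)
      have e2 := Finset.card_union_le (T1.image (fun w => (Sum.inl (w, l - 1) : (V × ℕ) ⊕ V)))
        (T2.image (fun w => Sum.inl (w, l + 1)))
      have e3 := Finset.card_image_le (s := T1) (f := fun w => (Sum.inl (w, l - 1) : (V × ℕ) ⊕ V))
      have e4 := Finset.card_image_le (s := T2) (f := fun w => (Sum.inl (w, l + 1) : (V × ℕ) ⊕ V))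
      have e5 := Finset.card_image_le (s := T3) (f := fun w => (Sum.inr w : (V × ℕ) ⊕ V))
      have := hA l
      split_ifs at hc1 hc2 hc3 <;> grind
    · intro x' y hx' hxy
      have hx's : D.spine x' := by
        by_contra hh
        rw [D.label_of_not_spine hh, D.label_of_spine hsp] at hx'
        cases hx'
      rw [D.label_of_spine hx's, D.label_of_spine hsp, Sum.inl.injEq, Prod.mk.injEq] at hx'
      obtain ⟨hb, hlev⟩ := hx'
      by_cases hy : D.spine y
      · rw [D.label_of_spine hy]
        simp only [Finset.mem_union, Finset.mem_image, Sum.inl.injEq, Prod.mk.injEq]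
        rcases D.spine_adj x' y hxy hx's hy with ⟨h, -⟩ | ⟨hbb, h | h⟩
        · omega
        · refine Or.inl (Or.inr ⟨_, h2 (D.base y) ?_, ?_, ?_⟩)
          · rw [← hbb, ← hb, hlev]
          · rw [h, hlev]
          · rw [h, hlev]
        · have hy1 : D.lev y = l - 1 := by omega
          refine Or.inl (Or.inl ⟨_, h1 (D.base y) ?_, ?_, ?_⟩)
          · rw [← hbb, ← hb, hlev]
          · rw [hy1]
          · rw [hy1]
      · rw [D.label_of_not_spine hy]
        exact Finset.mem_union_right _ (Finset.mem_image_of_mem _ (h3 x' y hxy hx's hy hlev))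
  · refine ⟨(G.verts.filter (fun y => G.Adj x y)).image (D.label (mix A u v c)),
      Finset.card_image_le.trans (D.free_card x hx hsp), ?_⟩
    intro x' y hx' hxy
    have : x' = x := by
      by_cases hx's : D.spine x'
      · rw [D.label_of_not_spine hsp, D.label_of_spine hx's] at hx'
        cases hx'
      · rw [D.label_of_not_spine hsp, D.label_of_not_spine hx's] at hx'
        exact Sum.inr.inj hx'
    subst this
    exact Finset.mem_image_of_mem _ (Finset.mem_filter.2 ⟨hxy.right_mem, hxy⟩)

theorem exists_label_neighbors_of_mem {A : ℕ → Prop} (h0 : A 0 → A 1) (u v : V) (c : V → V)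
    {x : V} (hx : x ∈ Q) :
    ∃ T : Finset ((V × ℕ) ⊕ V), T.card ≤ 1 ∧ ∀ x' y,
      D.label (mix A u v c) x' = D.label (mix A u v c) x → G.Adj x' y → y ∉ Q →
        D.label (mix A u v c) y ∈ T := by
  obtain ⟨T, hc, h⟩ := exists_mix_image A u v c 0 1 (mix A u v c 0 x)
  refine ⟨T.image (fun w => Sum.inl (w, 1)), Finset.card_image_le.trans ?_, ?_⟩
  · rwa [if_neg (by tauto)] at hc
  · intro x' y hx' hxy hy
    have hx'Q := D.mem_of_label_eq hx' hx
    obtain ⟨hs, hl⟩ := (D.mem_iff x').1 hx'Q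
    have hys : D.spine y := by
      by_contra hh
      have := D.exit_lev x' y hxy hs hh
      omega
    rw [D.label_of_mem hx'Q, D.label_of_mem hx, Sum.inl.injEq, Prod.mk.injEq] at hx'
    rcases D.spine_adj x' y hxy hs hys with ⟨-, h2⟩ | ⟨hb, h2 | h2⟩
    · exact (hy ((D.mem_iff y).2 ⟨hys, h2⟩)).elim
    · rw [D.label_of_spine hys, h2, hl, ← hb, D.base_self x' hx'Q]
      exact Finset.mem_image_of_mem _ (h x' hx'.1)
    · omega

variable {t w : ℕ}

theorem maxRedDeg_le (hw : w + 1 ≤ t) (h4 : 4 ≤ t) {A : ℕ → Prop} (h0 : A 0 → A 1)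
    (hA : ∀ l ≥ 2, A l → A (l - 1) ∨ A (l + 1)) {u v : V} {c : V → V} {S : Trigraph V}
    (hS : G.IsQuotient S (D.label (mix A u v c))) (hQ : (S.induce Q).maxRedDeg ≤ w) :
    S.maxRedDeg ≤ t := by
  refine Finset.sup_le fun s hs => ?_
  by_cases hsQ : s ∈ Q
  · obtain ⟨T, hc, hT⟩ := D.exists_label_neighbors_of_mem h0 u v c hsQ
    have h1 := hS.redDeg_le_induce hsQ T fun x y hx hxy ⟨z, hz, hzy⟩ =>
      hT x y hx hxy fun hy => (Finset.mem_sdiff.1 hz).2 (D.mem_of_label_eq hzy hy)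
    have h2 : (S.induce Q).redDeg s ≤ w :=
      (Finset.le_sup (f := (S.induce Q).redDeg) (Finset.mem_inter.2 ⟨hs, hsQ⟩)).trans hQ
    omega
  · obtain ⟨T, hc, hT⟩ := D.exists_label_neighbors hA u v c (hS.sub hs) hsQ
    have := hS.redDeg_le s T fun x y hx hxy _ => hT x y hx hxy
    omega

theorem mix_false (u v : V) (c : V → V) : mix (fun _ => False) u v c = fun _ => c := by
  funext l b; simp [mix]

/-- Identify `u` and `v` on one more level of the strands. -/
theorem exists_zip (hw : w + 1 ≤ t) (h4 : 4 ≤ t) {A A' : ℕ → Prop} {l : ℕ} (hl0 : l ≠ 0)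
    (hAA : ∀ k, A' k ↔ A k ∨ k = l) (h0 : A' 0 → A' 1)
    (hA : ∀ l ≥ 2, A' l → A' (l - 1) ∨ A' (l + 1)) {u v : V} (huv : u ≠ v) {c : V → V}
    {S : Trigraph V} (hS : G.IsQuotient S (D.label (mix A u v c))) (hr : G.Reaches t S)
    (hQ : (S.induce Q).maxRedDeg ≤ w) :
    ∃ S' : Trigraph V, G.IsQuotient S' (D.label (mix A' u v c)) ∧ G.Reaches t S' ∧
      S'.induce Q = S.induce Q := by
  refine hS.exists_relabel hr (a := Sum.inl (u, l)) (b := Sum.inl (v, l)) (by simpa using huv)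
    (D.label_mix hAA u v c) ?_ ?_
  · intro x hx
    rw [D.label_of_mem hx]
    simp [hl0.symm]
  · intro S' hS' hS'Q
    exact D.maxRedDeg_le hw h4 h0 hA hS' (hS'Q ▸ hQ)

/-- One contraction in `Q` followed by zipping the strands of the two contracted vertices. -/
theorem exists_contract (hw : w + 1 ≤ t) (h4 : 4 ≤ t) {u v : V} (huv : u ≠ v) {c : V → V}
    {S : Trigraph V} (hS : G.IsQuotient S (D.label fun _ => c)) (hr : G.Reaches t S)
    (hcS : ∀ x ∈ S.verts, x ∈ Q → c x = x) (hu : u ∈ (S.induce Q).verts)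
    (hv : v ∈ (S.induce Q).verts) (hQ : (S.induce Q).maxRedDeg ≤ w)
    (hQ' : ((S.induce Q).contract u v).maxRedDeg ≤ w) :
    ∃ S' : Trigraph V, G.IsQuotient S' (D.label fun _ b => if c b = v then u else c b) ∧
      G.Reaches t S' ∧ S'.induce Q = (S.induce Q).contract u v := by
  rw [← mix_false u v c] at hS
  obtain ⟨S₁, hS₁, hr₁, hQ₁⟩ := D.exists_zip hw h4 (A' := fun l => l = 1) one_ne_zero
    (by simp) (by simp) (by intro l hl h; omega) huv hS hr hQ
  obtain ⟨hu₁, huQ⟩ := Finset.mem_inter.1 (hQ₁ ▸ hu : u ∈ (S₁.induce Q).verts)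
  obtain ⟨hv₁, hvQ⟩ := Finset.mem_inter.1 (hQ₁ ▸ hv : v ∈ (S₁.induce Q).verts)
  have hcu : c u = u := hcS u (Finset.mem_inter.1 hu).1 huQ
  have hcv : c v = v := hcS v (Finset.mem_inter.1 hv).1 hvQ
  have hF : ∀ x, D.label (mix (fun l => l ≤ 1) u v c) x =
      if D.label (mix (fun l => l = 1) u v c) x = D.label (mix (fun l => l = 1) u v c) v
      then D.label (mix (fun l => l = 1) u v c) u
      else D.label (mix (fun l => l = 1) u v c) x := by
    intro x
    have e1 : D.label (mix (fun l => l = 1) u v c) v = Sum.inl (v, 0) := by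
      rw [D.label_of_mem hvQ]; simp [mix, hcv]
    have e2 : D.label (mix (fun l => l = 1) u v c) u = Sum.inl (u, 0) := by
      rw [D.label_of_mem huQ]; simp [mix, hcu]
    rw [e1, e2]
    exact D.label_mix (by intro k; omega) u v c x
  have hS₂ := hS₁.contract huv hu₁ hv₁ hF
  have hQ₂ : (S₁.contract u v).induce Q = (S.induce Q).contract u v := by
    rw [induce_contract_of_mem huv hu₁ hv₁ huQ hvQ, hQ₁]
  have hr₂ : G.Reaches t (S₁.contract u v) := hr₁.contract huv hu₁ hv₁
    (D.maxRedDeg_le hw h4 (by simp) (by intro l hl h; omega) hS₂ (hQ₂ ▸ hQ'))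
  have hzip : ∀ z : ℕ, ∃ S' : Trigraph V,
      G.IsQuotient S' (D.label (mix (fun l => l ≤ z + 1) u v c)) ∧ G.Reaches t S' ∧
        S'.induce Q = (S.induce Q).contract u v := by
    intro z
    induction z with
    | zero => exact ⟨_, hS₂, hr₂, hQ₂⟩
    | succ z ih =>
      obtain ⟨S', hS', hr', hQ''⟩ := ih
      obtain ⟨S'', h1, h2, h3⟩ := D.exists_zip hw h4 (A' := fun l => l ≤ z + 1 + 1)
        (l := z + 2) (by omega) (by intro k; omega) (by omega)
        (by intro l hl h; omega) huv hS' hr' (hQ''.symm ▸ hQ')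
      exact ⟨S'', h1, h2, h3.trans hQ''⟩
  obtain ⟨S', h1, h2, h3⟩ := hzip (G.verts.sup D.lev)
  refine ⟨S', h1.of_ker ?_, h2, h3⟩
  have key : ∀ x ∈ G.verts, D.label (mix (fun l => l ≤ G.verts.sup D.lev + 1) u v c) x =
      D.label (fun _ b => if c b = v then u else c b) x := by
    intro x hx
    have : D.lev x ≤ G.verts.sup D.lev := Finset.le_sup hx
    by_cases hs : D.spine x
    · rw [D.label_of_spine hs, D.label_of_spine hs]
      simp [mix, show D.lev x ≤ G.verts.sup D.lev + 1 by omega]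
    · rw [D.label_of_not_spine hs, D.label_of_not_spine hs]
  intro x hx y hy
  rw [key x hx, key y hy]

/-- A contraction sequence of the part on `Q` can be followed in the whole trigraph. -/
theorem exists_follow (hw : w + 1 ≤ t) (h4 : 4 ≤ t) (ps : List (V × V)) :
    ∀ (S : Trigraph V) (c : V → V), G.IsQuotient S (D.label fun _ => c) → G.Reaches t S →
      (∀ x ∈ S.verts, x ∈ Q → c x = x) → ValidSteps (S.induce Q) ps →
      (S.induce Q).seqWidth ps ≤ w →
      ∃ (S' : Trigraph V) (c' : V → V), G.IsQuotient S' (D.label fun _ => c') ∧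
        G.Reaches t S' ∧ (∀ x ∈ S'.verts, x ∈ Q → c' x = x) ∧
        S'.induce Q = stage (S.induce Q) ps := by
  induction ps with
  | nil => exact fun S c hS hr hc _ _ => ⟨S, c, hS, hr, hc, rfl⟩
  | cons p ps ih =>
    intro S c hS hr hc hval hwid
    obtain ⟨hne, hu, hv, hval⟩ := hval
    have hwid' := (seqWidth_contract_le (S.induce Q) p ps).trans hwid
    obtain ⟨S', hS', hr', hQ'⟩ := D.exists_contract hw h4 hne hS hr hc hu hv
      ((maxRedDeg_le_seqWidth _ _).trans hwid) ((maxRedDeg_le_seqWidth _ _).trans hwid')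
    rw [← hQ'] at hval hwid'
    obtain ⟨S'', c'', h1, h2, h3, h4⟩ := ih S' _ hS' hr' (by
      intro x hx hxQ
      have hx' : x ∈ ((S.induce Q).contract p.1 p.2).verts := by
        rw [← hQ']; exact Finset.mem_inter.2 ⟨hx, hxQ⟩
      rw [contract_verts hne hu hv, Finset.mem_erase, induce_verts, Finset.mem_inter] at hx'
      rw [hc x hx'.2.1 hxQ, if_neg hx'.1]) hval hwid'
    refine ⟨S'', c'', h1, h2, h3, ?_⟩
    rw [h4, hQ']
    rfl

theorem label_injOn : Set.InjOn (D.label fun _ b => b) G.verts := by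
  intro x hx y hy hxy
  by_cases hsx : D.spine x <;> by_cases hsy : D.spine y
  · rw [D.label_of_spine hsx, D.label_of_spine hsy, Sum.inl.injEq, Prod.mk.injEq] at hxy
    exact D.spine_inj x y hsx hsy hxy.2 hxy.1
  · rw [D.label_of_spine hsx, D.label_of_not_spine hsy] at hxy
    cases hxy
  · rw [D.label_of_not_spine hsx, D.label_of_spine hsy] at hxy
    cases hxy
  · rw [D.label_of_not_spine hsx, D.label_of_not_spine hsy] at hxy
    exact Sum.inr.inj hxy

/-- Position in the final sweep: each spine level is followed by the free column attached to it,
which is swept in the order of its rows. -/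
noncomputable def rank (x : V) : ℕ :=
  if D.spine x then D.lev x * (G.verts.sup D.row + 1)
  else D.col x * (G.verts.sup D.row + 1) + D.row x

theorem rank_of_spine {x : V} (h : D.spine x) :
    D.rank x = D.lev x * (G.verts.sup D.row + 1) := if_pos h

theorem rank_of_not_spine {x : V} (h : ¬ D.spine x) :
    D.rank x = D.col x * (G.verts.sup D.row + 1) + D.row x := if_neg h

theorem row_lt {x : V} (hx : x ∈ G.verts) : D.row x < G.verts.sup D.row + 1 :=
  Nat.lt_succ_of_le (Finset.le_sup hx)

theorem rank_div {x : V} (hx : x ∈ G.verts) :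
    D.rank x / (G.verts.sup D.row + 1) = if D.spine x then D.lev x else D.col x := by
  have h := D.row_lt hx
  by_cases hs : D.spine x
  · rw [D.rank_of_spine hs, if_pos hs, Nat.mul_div_cancel _ (Nat.succ_pos _)]
  · rw [D.rank_of_not_spine hs, if_neg hs, mul_comm, Nat.mul_add_div (Nat.succ_pos _),
      Nat.div_eq_of_lt h, add_zero]

theorem rank_mod {x : V} (hx : x ∈ G.verts) :
    D.rank x % (G.verts.sup D.row + 1) = if D.spine x then 0 else D.row x := by
  have h := D.row_lt hx
  by_cases hs : D.spine x
  · rw [D.rank_of_spine hs, if_pos hs, Nat.mul_mod_left]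
  · rw [D.rank_of_not_spine hs, if_neg hs, mul_comm, Nat.mul_add_mod, Nat.mod_eq_of_lt h]

theorem rank_eq_iff {x y : V} (hx : x ∈ G.verts) (hy : y ∈ G.verts) :
    D.rank x = D.rank y ↔
      (D.spine x ∧ D.spine y ∧ D.lev x = D.lev y) ∨ (¬ D.spine x ∧ x = y) := by
  constructor
  · intro h
    have h1 := D.rank_div hx
    have h2 := D.rank_mod hx
    rw [h, D.rank_div hy] at h1
    rw [h, D.rank_mod hy] at h2
    have h3 := D.row_pos x
    have h4 := D.row_pos y
    have h5 := D.free_inj x hx y hy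
    grind
  · rintro (⟨h1, h2, h3⟩ | ⟨-, rfl⟩)
    · rw [D.rank_of_spine h1, D.rank_of_spine h2, h3]
    · rfl

/-- The boundary of the swept part consists of at most three classes. -/
theorem exists_rank_mem_of_lt (τ : ℕ) : ∃ T : Finset ℕ, T.card ≤ 3 ∧
    ∀ x y, G.Adj x y → D.rank x ≤ τ → τ < D.rank y → D.rank y ∈ T := by
  refine ⟨{(τ / (G.verts.sup D.row + 1) + 1) * (G.verts.sup D.row + 1),
    τ / (G.verts.sup D.row + 1) * (G.verts.sup D.row + 1) + τ / (G.verts.sup D.row + 1) + 1,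
    τ + 1}, Finset.card_le_three, fun x y hxy hx hy => ?_⟩
  have hdx := D.rank_div hxy.left_mem
  have hdy := D.rank_div hxy.right_mem
  have hlx := Nat.div_le_div_right (c := G.verts.sup D.row + 1) hx
  have hly := Nat.div_le_div_right (c := G.verts.sup D.row + 1) hy.le
  rw [hdx] at hlx
  rw [hdy] at hly
  have hτ := Nat.div_add_mod τ (G.verts.sup D.row + 1)
  rw [mul_comm] at hτ
  have hrow := D.row_lt hxy.right_mem
  have hspine : D.spine y → τ / (G.verts.sup D.row + 1) ≠ D.lev y := by
    intro hs he
    rw [D.rank_of_spine hs, ← he] at hy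
    omega
  simp only [Finset.mem_insert, Finset.mem_singleton]
  by_cases hsx : D.spine x <;> by_cases hsy : D.spine y <;>
    simp only [hsx, hsy, if_true, if_false] at hlx hly
  · left
    have := hspine hsy
    rw [D.rank_of_spine hsy]
    congr 1
    rcases D.spine_adj x y hxy hsx hsy with h | ⟨-, h | h⟩ <;> omega
  · rcases D.exit_col x y hxy hsx hsy with ⟨h1, h2⟩ | h
    · right; left
      rw [D.rank_of_not_spine hsy, h2, show D.col y = τ / (G.verts.sup D.row + 1) by omega,
        show D.lev x = τ / (G.verts.sup D.row + 1) by omega, add_assoc]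
    · omega
  · left
    have := hspine hsy
    rw [D.rank_of_spine hsy]
    congr 1
    rcases D.exit_col y x hxy.symm hsy hsx with ⟨h1, h2⟩ | h <;> omega
  · right; right
    rw [D.rank_of_not_spine hsx] at hx
    rw [D.rank_of_not_spine hsy] at hy ⊢
    obtain ⟨h1, h2⟩ := D.free_adj x y hxy hsx hsy
    rw [h1] at hx
    omega

theorem maxRedDeg_le_of_sweep {t : ℕ} (h4 : 4 ≤ t) {S : Trigraph V} (τ : ℕ)
    (hS : G.IsQuotient S fun x => max (D.rank x) τ) : S.maxRedDeg ≤ t := by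
  refine Finset.sup_le fun s hs => ?_
  have hsG := hS.sub hs
  rcases le_or_gt (D.rank s) τ with hsτ | hsτ
  · obtain ⟨T, hc, hT⟩ := D.exists_rank_mem_of_lt τ
    refine (hS.redDeg_le s T fun x y hx hxy hy => ?_).trans (by omega)
    have hyτ : τ < D.rank y := by omega
    rw [max_eq_left hyτ.le]
    exact hT x y hxy (by omega) hyτ
  · by_cases hsp : D.spine s
    · obtain ⟨T, hc, hT⟩ := D.exists_exit (D.lev s)
      refine (hS.redDeg_le s
        ({max ((D.lev s - 1) * (G.verts.sup D.row + 1)) τ,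
          max ((D.lev s + 1) * (G.verts.sup D.row + 1)) τ} ∪ T.image fun x => max (D.rank x) τ)
        fun x y hx hxy _ => ?_).trans ?_
      · have hxs : D.rank x = D.rank s := by omega
        rw [D.rank_eq_iff hxy.left_mem hsG] at hxs
        obtain ⟨hsx, -, hlev⟩ | ⟨hsx, rfl⟩ := hxs
        swap
        · exact (hsx hsp).elim
        by_cases hsy : D.spine y
        · refine Finset.mem_union_left _ ?_
          rw [Finset.mem_insert, Finset.mem_singleton, D.rank_of_spine hsy]
          rcases D.spine_adj x y hxy hsx hsy with ⟨h, -⟩ | ⟨-, h | h⟩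
          · rw [D.rank_of_spine hsp, ← hlev, h] at hsτ
            omega
          · right; rw [h, hlev]
          · left; rw [← hlev, h, Nat.add_sub_cancel]
        · exact Finset.mem_union_right _ (Finset.mem_image_of_mem _ (hT x y hxy hsx hsy hlev))
      · have e1 := Finset.card_union_le
          ({max ((D.lev s - 1) * (G.verts.sup D.row + 1)) τ,
            max ((D.lev s + 1) * (G.verts.sup D.row + 1)) τ} : Finset ℕ)
          (T.image fun x => max (D.rank x) τ)
        have e2 := Finset.card_image_le (s := T) (f := fun x => max (D.rank x) τ)
        have e3 := Finset.card_le_two (a := max ((D.lev s - 1) * (G.verts.sup D.row + 1)) τ)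
          (b := max ((D.lev s + 1) * (G.verts.sup D.row + 1)) τ)
        split_ifs at hc <;> omega
    · refine (hS.redDeg_le s ((G.verts.filter (fun y => G.Adj s y)).image
        fun x => max (D.rank x) τ) fun x y hx hxy _ => ?_).trans
        (Finset.card_image_le.trans ((D.free_card s hsG hsp).trans h4))
      have hxs : D.rank x = D.rank s := by omega
      rw [D.rank_eq_iff hxy.left_mem hsG] at hxs
      obtain ⟨-, h, -⟩ | ⟨-, rfl⟩ := hxs
      · exact (hsp h).elim
      · exact Finset.mem_image_of_mem _ (Finset.mem_filter.2 ⟨hxy.right_mem, hxy⟩)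

/-- Once `Q` has been contracted to a single vertex, everything else can be swept into it. -/
theorem exists_sweep {t : ℕ} (h4 : 4 ≤ t) (hQG : Q ⊆ G.verts) {c : V → V} {S : Trigraph V}
    (hS : G.IsQuotient S (D.label fun _ => c)) (hr : G.Reaches t S)
    (hcS : ∀ x ∈ S.verts, x ∈ Q → c x = x) (hcard : (S.induce Q).verts.card = 1) :
    ∃ S' : Trigraph V, G.Reaches t S' ∧ S'.verts.card = 1 := by
  obtain ⟨h, hh⟩ := Finset.card_eq_one.1 hcard
  obtain ⟨-, hhQ⟩ := Finset.mem_inter.1 (hh ▸ Finset.mem_singleton_self h : h ∈ (S.induce Q).verts)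
  have hc : ∀ b ∈ Q, c b = h := by
    intro b hb
    obtain ⟨s, hs, hsb⟩ := hS.surj b (hQG hb)
    have hsQ := D.mem_of_label_eq hsb hb
    rw [D.label_of_mem hsQ, D.label_of_mem hb, Sum.inl.injEq, Prod.mk.injEq, hcS s hs hsQ] at hsb
    have : s ∈ (S.induce Q).verts := Finset.mem_inter.2 ⟨hs, hsQ⟩
    rw [hh, Finset.mem_singleton] at this
    rw [← hsb.1, this]
  have hsweep : ∀ τ : ℕ, ∃ S' : Trigraph V,
      G.IsQuotient S' (fun x => max (D.rank x) τ) ∧ G.Reaches t S' := by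
    intro τ
    induction τ with
    | zero =>
      refine ⟨S, hS.of_ker ?_, hr⟩
      intro x hx y hy
      rw [Nat.max_zero, Nat.max_zero, D.rank_eq_iff hx hy]
      by_cases hsx : D.spine x <;> by_cases hsy : D.spine y
      · rw [D.label_of_spine hsx, D.label_of_spine hsy, hc _ (D.base_mem x hsx),
          hc _ (D.base_mem y hsy)]
        simp [hsx, hsy]
      · rw [D.label_of_spine hsx, D.label_of_not_spine hsy]
        simp [hsx, hsy]
      · rw [D.label_of_not_spine hsx, D.label_of_spine hsy]
        simp only [reduceCtorEq, hsx, false_and, not_false_eq_true, true_and, false_or, false_iff]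
        rintro rfl
        exact hsx hsy
      · rw [D.label_of_not_spine hsx, D.label_of_not_spine hsy]
        simp [hsx]
    | succ τ ih =>
      obtain ⟨S', hS', hr'⟩ := ih
      obtain ⟨S'', h1, h2, -⟩ := hS'.exists_relabel (Q := ∅) hr' (a := τ + 1) (b := τ)
        (F' := fun x => max (D.rank x) (τ + 1)) (by omega) (by intro x; split_ifs <;> omega)
        (by simp) fun S'' hS'' _ => D.maxRedDeg_le_of_sweep h4 _ hS''
      exact ⟨S'', h1, h2⟩
  obtain ⟨S', hS', hr'⟩ := hsweep (G.verts.sup D.rank)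
  have hF : ∀ x ∈ G.verts, max (D.rank x) (G.verts.sup D.rank) = G.verts.sup D.rank :=
    fun x hx => max_eq_right (Finset.le_sup hx)
  refine ⟨S', hr', Finset.card_eq_one.2 ?_⟩
  obtain ⟨s, hs, -⟩ := hS'.surj h (hQG hhQ)
  refine ⟨s, Finset.eq_singleton_iff_unique_mem.2 ⟨hs, fun x hx => hS'.inj hx hs ?_⟩⟩
  rw [hF x (hS'.sub hx), hF s (hS'.sub hs)]

end Coords

/-- A contraction sequence of the part on `Q` extends to one of the whole trigraph. -/
theorem Coords.exists_contractionSeq {G : Trigraph V} {Q : Finset V} (D : Coords G Q)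
    (hQG : Q ⊆ G.verts) {ps : List (V × V)}
    (hps : (G.induce Q).IsContractionSeq ps) :
    ∃ ps' : List (V × V), G.IsContractionSeq ps' ∧
      G.seqWidth ps' ≤ max ((G.induce Q).seqWidth ps + 1) 4 := by
  set t := max ((G.induce Q).seqWidth ps + 1) 4 with ht
  have hw : (G.induce Q).seqWidth ps + 1 ≤ t := le_max_left _ _
  have h4 : 4 ≤ t := le_max_right _ _
  have hG : G.IsQuotient G (D.label fun _ b => b) := IsQuotient.self D.label_injOn
  have hdeg : G.maxRedDeg ≤ t := by
    rcases G.verts.eq_empty_or_nonempty with h | ⟨u, -⟩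
    · simp [maxRedDeg, h]
    · refine D.maxRedDeg_le hw h4 (A := fun _ => False) (u := u) (v := u) (c := fun b => b)
        (by simp) (by simp) ?_ (maxRedDeg_le_seqWidth _ _)
      rwa [mix_false]
  obtain ⟨S, c, h1, h2, h3, h5⟩ := D.exists_follow hw h4 ps G (fun b => b) hG (.refl hdeg)
    (fun _ _ _ => rfl) hps.1 le_rfl
  obtain ⟨S', ⟨ps', hval, rfl, hwid⟩, hcard⟩ := D.exists_sweep h4 hQG h1 h2 h3 (h5 ▸ hps.2)
  exact ⟨ps', ⟨hval, hcard⟩, hwid⟩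

variable {G : Trigraph V} {HV : Finset V} {P : Finset (List V)}

/-- Numbered positions on the paths of a tidy trigraph: the path number `J`, the position `I` on
it, its length `N`, and the two vertices `f`, `b` outside to which its ends are attached. -/
structure PathCoords (G : Trigraph V) (HV : Finset V) (m : ℕ) where
  J : V → ℕ
  I : V → ℕ
  N : V → ℕ
  f : V → V
  b : V → V
  J_lt : ∀ x ∈ G.verts, x ∉ HV → J x < m
  I_lt : ∀ x ∈ G.verts, x ∉ HV → I x < N x
  le_N : ∀ x ∈ G.verts, x ∉ HV → 8 * m ≤ N x
  f_mem : ∀ x ∈ G.verts, x ∉ HV → f x ∈ HV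
  b_mem : ∀ x ∈ G.verts, x ∉ HV → b x ∈ HV
  congr_J : ∀ x ∈ G.verts, x ∉ HV → ∀ y ∈ G.verts, y ∉ HV → J x = J y →
    N x = N y ∧ f x = f y ∧ b x = b y
  inj : ∀ x ∈ G.verts, x ∉ HV → ∀ y ∈ G.verts, y ∉ HV → J x = J y → I x = I y → x = y
  f_inj : ∀ x ∈ G.verts, x ∉ HV → ∀ y ∈ G.verts, y ∉ HV → f x = f y → J x = J y
  b_inj : ∀ x ∈ G.verts, x ∉ HV → ∀ y ∈ G.verts, y ∉ HV → b x = b y → J x = J y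
  f_ne_b : ∀ x ∈ G.verts, x ∉ HV → ∀ y ∈ G.verts, y ∉ HV → f x ≠ b y
  adj : ∀ x y, G.Adj x y → x ∉ HV → y ∉ HV → J x = J y ∧ (I y = I x + 1 ∨ I x = I y + 1)
  adj_mem : ∀ x y, G.Adj x y → x ∉ HV → y ∈ HV →
    (I x = 0 ∧ y = f x) ∨ (I x + 1 = N x ∧ y = b x)
  card_le : ∀ x ∈ G.verts, x ∉ HV → (G.verts.filter (fun y => G.Adj x y)).card ≤ 2

/-- On the path number `j`, the first `2 j + 2` and the last `2 j + 3` vertices belong to the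
spine, so that the spine is left at pairwise distinct levels. -/
noncomputable def PathCoords.toCoords {m : ℕ} (D : PathCoords G HV m) :
    Coords G HV where
  spine x := x ∈ HV ∨
    (x ∈ G.verts ∧ (D.I x + 1 ≤ 2 * D.J x + 2 ∨ D.N x ≤ D.I x + (2 * D.J x + 3)))
  lev x := if x ∈ HV then 0 else if D.I x + 1 ≤ 2 * D.J x + 2 then D.I x + 1 else D.N x - D.I x
  base x := if x ∈ HV then x else if D.I x + 1 ≤ 2 * D.J x + 2 then D.f x else D.b x
  col x := 2 * D.J x + 2
  row x := D.I x + 1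
  mem_iff x := by
    have := D.I_lt x
    grind
  base_self x hx := by simp [hx]
  base_mem x hx := by
    have := D.f_mem x
    have := D.b_mem x
    grind
  spine_inj x y hx hy hl hb := by
    have hx' := D.I_lt x
    have hy' := D.I_lt y
    have h1 := D.congr_J x
    have h2 := D.inj x
    have h3 := D.f_inj x
    have h4 := D.b_inj x
    have h5 := D.f_ne_b x
    have h6 := D.f_ne_b y
    grind
  spine_adj x y hxy hx hy := by
    have hx' := hxy.left_mem
    have hy' := hxy.right_mem
    have h1 := D.adj x y hxy
    have h2 := D.adj_mem x y hxy
    have h3 := D.adj_mem y x hxy.symm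
    have h4 := D.congr_J x hx'
    have h5 := D.J_lt x hx'
    have h6 := D.J_lt y hy'
    have h7 := D.le_N x hx'
    have h8 := D.le_N y hy'
    have h9 := D.I_lt x hx'
    have h10 := D.I_lt y hy'
    grind
  exit_lev x y hxy hx hy := by
    have hx' := hxy.left_mem
    have hy' := hxy.right_mem
    have h1 := D.adj x y hxy
    have h3 := D.adj_mem y x hxy.symm
    have h4 := D.congr_J x hx'
    grind
  exit_unique x y x' y' hxy hx hy hxy' hx' hy' hl := by
    have hxv := hxy.left_mem
    have hyv := hxy.right_mem
    have hxv' := hxy'.left_mem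
    have hyv' := hxy'.right_mem
    have h1 := D.adj x y hxy
    have h2 := D.adj x' y' hxy'
    have h3 := D.adj_mem y x hxy.symm
    have h4 := D.adj_mem y' x' hxy'.symm
    have h5 := D.congr_J x hxv
    have h6 := D.congr_J x' hxv'
    have h7 := D.inj y hyv
    grind
  exit_col x y hxy hx hy := by
    have hx' := hxy.left_mem
    have hy' := hxy.right_mem
    have h1 := D.adj x y hxy
    have h3 := D.adj_mem y x hxy.symm
    have h4 := D.congr_J x hx'
    grind
  free_card x hx hs := (D.card_le x hx (by tauto)).trans (by norm_num)
  free_inj x hx y hy hsx hsy hc hr :=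
    D.inj x hx (by tauto) y hy (by tauto) (by omega) (by omega)
  free_adj x y hxy hx hy := by
    have h1 := D.adj x y hxy (by tauto) (by tauto)
    omega
  row_pos x _ := Nat.succ_pos _

theorem exists_other_neighbor {x z : V} (h : G.deg x = 2) (hz : G.Adj x z) :
    ∃ y, y ≠ z ∧ G.Adj x y ∧ ∀ w, G.Adj x w → w = y ∨ w = z := by
  have hmem : ∀ y, y ∈ G.verts.filter (fun y => G.Adj x y) ↔ G.Adj x y :=
    fun y => Finset.mem_filter.trans ⟨fun hy => hy.2, fun hy => ⟨hy.right_mem, hy⟩⟩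
  rw [deg_eq, Finset.card_eq_two] at h
  obtain ⟨a, b, hab, h⟩ := h
  simp only [h, Finset.mem_insert, Finset.mem_singleton] at hmem
  rcases (hmem z).2 hz with rfl | rfl
  · exact ⟨b, hab.symm, (hmem b).1 (Or.inr rfl), fun w hw => ((hmem w).2 hw).symm⟩
  · exact ⟨a, hab, (hmem a).1 (Or.inl rfl), fun w hw => (hmem w).2 hw⟩

theorem exists_getElem_of_pair_infix {α : Type*} {p : List α} {x y : α} (h : [x, y] <:+: p) :
    ∃ (k : ℕ) (hk : k + 1 < p.length), p[k] = x ∧ p[k + 1] = y := by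
  obtain ⟨s, r, rfl⟩ := h
  exact ⟨s.length, by simp, by simp, by simp⟩

namespace IsTidy

theorem adj_succ (ht : IsTidy G HV P) {p : List V} (hp : p ∈ P) (i : ℕ) (hi : i + 1 < p.length) :
    G.Adj p[i] p[i + 1] :=
  Or.inr (List.isChain_iff_getElem.1 (ht.paths p hp).2.2.1 i hi)

theorem path_eq (ht : IsTidy G HV P) {p q : List V} (hp : p ∈ P) (hq : q ∈ P) {x : V}
    (hxp : x ∈ p) (hxq : x ∈ q) :
    p = q := by
  by_contra h
  exact ht.pathsDisj p hp q hq h x hxp hxq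

theorem path_eq_of_adj (ht : IsTidy G HV P) {p q : List V} (hp : p ∈ P) (hq : q ∈ P) {x y : V}
    (hxp : x ∈ p)
    (hyq : y ∈ q) (hxy : G.Adj x y) : p = q := by
  by_contra h
  exact ht.noPathPathEdges p hp q hq h x hxp y hyq hxy

theorem consecutive (ht : IsTidy G HV P) {p : List V} (hp : p ∈ P) {i j : ℕ} (hi : i < p.length)
    (hj : j < p.length)
    (hij : G.Adj p[i] p[j]) : j = i + 1 ∨ i = j + 1 := by
  have hnd := (ht.paths p hp).2.1
  have key : ∀ k l (hk : k < p.length) (hl : l < p.length), [p[k], p[l]] <:+: p → l = k + 1 := by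
    intro k l hk hl h
    obtain ⟨n, hn, h1, h2⟩ := exists_getElem_of_pair_infix h
    rw [hnd.getElem_inj_iff] at h1 h2
    omega
  exact (ht.pathsInduced p hp _ (List.getElem_mem hi) _ (List.getElem_mem hj) hij).imp
    (key i j hi hj) (key j i hj hi)

/-- The two vertices of `H` to which a path is attached. -/
theorem exists_ends (ht : IsTidy G HV P) {p : List V} (hp : p ∈ P) (hlen : 2 ≤ p.length) :
    ∃ f ∈ HV, ∃ b ∈ HV, (∃ x ∈ p, G.Adj f x ∧ p.idxOf x = 0) ∧
      (∃ x ∈ p, G.Adj b x ∧ p.idxOf x + 1 = p.length) ∧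
      ∀ x ∈ p, ∀ y ∈ HV, G.Adj x y →
        (p.idxOf x = 0 ∧ y = f) ∨ (p.idxOf x + 1 = p.length ∧ y = b) := by
  have hnd := (ht.paths p hp).2.1
  have hmem : ∀ i (hi : i < p.length), p[i] ∉ HV :=
    fun i hi => ht.Hdisj p hp _ (List.getElem_mem hi)
  have hdeg : ∀ i (hi : i < p.length), G.deg p[i] = 2 :=
    fun i hi => ((ht.paths p hp).2.2.2 _ (List.getElem_mem hi)).2
  have hend : ∀ i j (hi : i < p.length) (hj : j < p.length), G.Adj p[i] p[j] →
      (∀ k (hk : k < p.length), G.Adj p[i] p[k] → k = j) →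
      ∃ u ∈ HV, G.Adj u p[i] ∧ ∀ y ∈ HV, G.Adj p[i] y → y = u := by
    intro i j hi hj hij huniq
    obtain ⟨y, hne, hy, hall⟩ := exists_other_neighbor (hdeg i hi) hij
    refine ⟨y, ?_, hy.symm, fun z hz hiz => (hall z hiz).resolve_right ?_⟩
    · refine (ht.cover y hy.right_mem).resolve_right ?_
      rintro ⟨q, hq, hyq⟩
      obtain rfl := ht.path_eq_of_adj hp hq (List.getElem_mem hi) hyq hy
      obtain ⟨k, hk, rfl⟩ := List.getElem_of_mem hyq
      have := huniq k hk hy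
      subst this
      exact hne rfl
    · rintro rfl
      exact hmem j hj hz
  obtain ⟨f, hf, hfa, hfu⟩ := hend 0 1 (by omega) (by omega) (ht.adj_succ hp 0 (by omega))
    fun k hk hadj => by have := ht.consecutive hp _ hk hadj; omega
  have hlast : G.Adj p[p.length - 1] p[p.length - 2] := by
    have := (ht.adj_succ hp (p.length - 2) (by omega)).symm
    simpa only [show p.length - 2 + 1 = p.length - 1 by omega] using this
  obtain ⟨b, hb, hba, hbu⟩ := hend (p.length - 1) (p.length - 2) (by omega) (by omega) hlast
    fun k hk hadj => by have := ht.consecutive hp _ hk hadj; omega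
  refine ⟨f, hf, b, hb, ⟨_, List.getElem_mem _, hfa, hnd.idxOf_getElem _ _⟩,
    ⟨_, List.getElem_mem _, hba, by rw [hnd.idxOf_getElem]; omega⟩, fun x hx y hy hxy => ?_⟩
  obtain ⟨i, hi, rfl⟩ := List.getElem_of_mem hx
  rw [hnd.idxOf_getElem]
  rcases Nat.eq_zero_or_pos i with rfl | hi0
  · exact Or.inl ⟨rfl, hfu y hy hxy⟩
  by_cases hin : i + 1 = p.length
  · obtain rfl : i = p.length - 1 := by omega
    exact Or.inr ⟨hin, hbu y hy hxy⟩
  · exfalso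
    obtain ⟨i, rfl⟩ : ∃ k, i = k + 1 := ⟨i - 1, by omega⟩
    have h1 := (ht.adj_succ hp i hi).symm
    have h2 := ht.adj_succ hp (i + 1) (by omega)
    obtain ⟨z, -, hz, hall⟩ := exists_other_neighbor (hdeg _ hi) h1
    have h3 : p[i + 1 + 1] ≠ p[i] := by
      rw [Ne, hnd.getElem_inj_iff]; omega
    obtain rfl := (hall _ h2).resolve_right h3
    rcases hall y hxy with rfl | rfl
    · exact hmem _ _ hy
    · exact hmem _ _ hy

theorem eq_of_adj_adj (ht : IsTidy G HV P) {u : V} (hu : u ∈ HV) {p q : List V} (hp : p ∈ P)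
    (hq : q ∈ P) {x y : V}
    (hx : x ∈ p) (hy : y ∈ q) (hux : G.Adj u x) (huy : G.Adj u y) : x = y :=
  (ht.boundary u hu y ⟨q, hq, hy⟩ huy).2 x ⟨p, hp, hx⟩ hux

theorem exists_pathCoords (ht : IsTidy G HV P) (hlong : ∀ p ∈ P, 8 * P.card ≤ p.length) :
    Nonempty (PathCoords G HV P.card) := by
  have hP : 0 < P.card := Finset.card_pos.2 ht.Pne
  have hlen : ∀ p ∈ P, 2 ≤ p.length := fun p hp => by have := hlong p hp; omega
  have hpath : ∀ x, ∃ p, x ∈ G.verts → x ∉ HV → p ∈ P ∧ x ∈ p := by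
    intro x
    by_cases h : x ∈ G.verts ∧ x ∉ HV
    · obtain ⟨p, hp, hx⟩ := (ht.cover x h.1).resolve_left h.2
      exact ⟨p, fun _ _ => ⟨hp, hx⟩⟩
    · exact ⟨[], fun h1 h2 => (h ⟨h1, h2⟩).elim⟩
  choose π hπ using hpath
  have hends : ∀ p, ∃ f b, p ∈ P → f ∈ HV ∧ b ∈ HV ∧ (∃ x ∈ p, G.Adj f x ∧ p.idxOf x = 0) ∧
      (∃ x ∈ p, G.Adj b x ∧ p.idxOf x + 1 = p.length) ∧
      ∀ x ∈ p, ∀ y ∈ HV, G.Adj x y →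
        (p.idxOf x = 0 ∧ y = f) ∨ (p.idxOf x + 1 = p.length ∧ y = b) := by
    intro p
    by_cases hp : p ∈ P
    · obtain ⟨f, hf, b, hb, h⟩ := ht.exists_ends hp (hlen p hp)
      exact ⟨f, b, fun _ => ⟨hf, hb, h⟩⟩
    · obtain ⟨u, -⟩ := ht.conn.1
      exact ⟨u, u, fun h => (hp h).elim⟩
  choose φ β hφβ using hends
  have hJ : ∀ x ∈ G.verts, x ∉ HV → ∀ y ∈ G.verts, y ∉ HV →
      P.toList.idxOf (π x) = P.toList.idxOf (π y) → π x = π y := fun x hx hx' y hy hy' h =>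
    (List.idxOf_inj (Finset.mem_toList.2 (hπ x hx hx').1)).1 h
  refine ⟨{
    J := fun x => P.toList.idxOf (π x)
    I := fun x => (π x).idxOf x
    N := fun x => (π x).length
    f := fun x => φ (π x)
    b := fun x => β (π x)
    J_lt := ?_
    I_lt := ?_
    le_N := ?_
    f_mem := ?_
    b_mem := ?_
    congr_J := ?_
    inj := ?_
    f_inj := ?_
    b_inj := ?_
    f_ne_b := ?_
    adj := ?_
    adj_mem := ?_
    card_le := ?_ }⟩
  · intro x hx hx'
    rw [← Finset.length_toList]
    exact List.idxOf_lt_length_iff.2 (Finset.mem_toList.2 (hπ x hx hx').1)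
  · exact fun x hx hx' => List.idxOf_lt_length_iff.2 (hπ x hx hx').2
  · exact fun x hx hx' => hlong _ (hπ x hx hx').1
  · exact fun x hx hx' => (hφβ _ (hπ x hx hx').1).1
  · exact fun x hx hx' => (hφβ _ (hπ x hx hx').1).2.1
  · intro x hx hx' y hy hy' h
    rw [hJ x hx hx' y hy hy' h]
    exact ⟨rfl, rfl, rfl⟩
  · intro x hx hx' y hy hy' h hI
    have h1 := hJ x hx hx' y hy hy' h
    rw [← h1] at hI
    exact (List.idxOf_inj (hπ x hx hx').2).1 hI
  · intro x hx hx' y hy hy' h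
    obtain ⟨hu, -, ⟨a, ha, hua, -⟩, -⟩ := hφβ _ (hπ x hx hx').1
    obtain ⟨-, -, ⟨b, hb, hub, -⟩, -⟩ := hφβ _ (hπ y hy hy').1
    rw [← h] at hub
    obtain rfl := ht.eq_of_adj_adj hu (hπ x hx hx').1 (hπ y hy hy').1 ha hb hua hub
    rw [ht.path_eq (hπ x hx hx').1 (hπ y hy hy').1 ha hb]
  · intro x hx hx' y hy hy' h
    obtain ⟨-, hu, -, ⟨a, ha, hua, -⟩, -⟩ := hφβ _ (hπ x hx hx').1
    obtain ⟨-, -, -, ⟨b, hb, hub, -⟩, -⟩ := hφβ _ (hπ y hy hy').1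
    rw [← h] at hub
    obtain rfl := ht.eq_of_adj_adj hu (hπ x hx hx').1 (hπ y hy hy').1 ha hb hua hub
    rw [ht.path_eq (hπ x hx hx').1 (hπ y hy hy').1 ha hb]
  · intro x hx hx' y hy hy' h
    obtain ⟨hu, -, ⟨a, ha, hua, ha0⟩, -⟩ := hφβ _ (hπ x hx hx').1
    obtain ⟨-, -, -, ⟨b, hb, hub, hb1⟩, -⟩ := hφβ _ (hπ y hy hy').1
    rw [← h] at hub
    obtain rfl := ht.eq_of_adj_adj hu (hπ x hx hx').1 (hπ y hy hy').1 ha hb hua hub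
    rw [ht.path_eq (hπ x hx hx').1 (hπ y hy hy').1 ha hb] at ha0
    have := hlen _ (hπ y hy hy').1
    omega
  · intro x y hxy hx' hy'
    obtain ⟨hp, hx⟩ := hπ x hxy.left_mem hx'
    obtain ⟨hq, hy⟩ := hπ y hxy.right_mem hy'
    have heq := ht.path_eq_of_adj hp hq hx hy hxy
    rw [← heq] at hy ⊢
    refine ⟨rfl, ht.consecutive hp (List.idxOf_lt_length_iff.2 hx)
      (List.idxOf_lt_length_iff.2 hy) ?_⟩
    rwa [List.getElem_idxOf, List.getElem_idxOf]
  · intro x y hxy hx' hy'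
    obtain ⟨hp, hx⟩ := hπ x hxy.left_mem hx'
    exact (hφβ _ hp).2.2.2.2 x hx y hy' hxy
  · intro x hx hx'
    obtain ⟨hp, hxp⟩ := hπ x hx hx'
    rw [← deg_eq, ((ht.paths _ hp).2.2.2 x hxp).2]

end IsTidy

end Trigraph

open Trigraph

/-- **Corollary 11.** Let `G` be a tidy `(H,𝒫)`-graph in which every path of `𝒫` has at least
`8·|𝒫|` vertices. Given a contraction sequence `C_H` of `H`, the graph `G` admits a
contraction sequence of width at most `max(w(C_H) + 1, 4)`. -/
theorem tidy_contraction_sequence {V : Type u} (G : Trigraph V) (HV : Finset V)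
    (P : Finset (List V)) (ht : IsTidy G HV P)
    (hlong : ∀ p ∈ P, 8 * P.card ≤ p.length)
    (psH : List (V × V)) (hH : (G.induce HV).IsContractionSeq psH) :
    ∃ ps : List (V × V), G.IsContractionSeq ps ∧
      G.seqWidth ps ≤ max ((G.induce HV).seqWidth psH + 1) 4 := by
  obtain ⟨D⟩ := ht.exists_pathCoords hlong
  exact D.toCoords.exists_contractionSeq ht.Hsub hH
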